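/- arXiv:1711.09178 — 2 statements merged into one kernel-verified Lean document; each statement's English description precedes it below -/
import Mathlib

section
/- Let H be a balanced hypergraph. Then the cover ideal J(H) is normally torsion-free, i.e., J(H)^s = J(H)^{(s)} for all s ≥ 1. -/
open MvPolynomial

/-- A hypergraph is balanced if every odd cycle (length `2m+3`) has an edge containing
at least three vertices of the cycle. -/
def IsBalanced {V : Type*} [DecidableEq V] (E : Finset (Finset V)) : Prop :=
  ∀ (m : ℕ) (v : Fin (2 * m + 3) → V) (e : Fin (2 * m + 3) → Finset V),
    Function.Injective v → Function.Injective e → (∀ i, e i ∈ E) →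
    (∀ i, v i ∈ e i ∧ v (i + 1) ∈ e i) →
    ∃ t, 3 ≤ (Finset.univ.filter fun j => v j ∈ e t).card

/-- The cover ideal `J(H) = ⋂_{e ∈ E} (x_i : i ∈ e)`. -/
noncomputable def coverIdeal {n : ℕ} (K : Type*) [Field K] (E : Finset (Finset (Fin n))) :
    Ideal (MvPolynomial (Fin n) K) :=
  ⨅ e ∈ E, Ideal.span {p : MvPolynomial (Fin n) K | ∃ i ∈ e, p = X i}

/-- The `s`-th symbolic power `J(H)^{(s)} = ⋂_{e ∈ E} (x_i : i ∈ e)^s`. -/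
noncomputable def coverIdealSymbPow {n : ℕ} (K : Type*) [Field K]
    (E : Finset (Finset (Fin n))) (s : ℕ) : Ideal (MvPolynomial (Fin n) K) :=
  ⨅ e ∈ E, (Ideal.span {p : MvPolynomial (Fin n) K | ∃ i ∈ e, p = X i}) ^ s


section Combinatorics

variable {V W : Type*} [DecidableEq V] [DecidableEq W]

/-- the trace of an edge on a set of (copies of) vertices -/
def trc (f : W → V) (S : Finset W) (e : Finset V) : Finset W := S.filter fun w => f w ∈ e

lemma mem_trc {f : W → V} {S : Finset W} {e : Finset V} {w : W} :
    w ∈ trc f S e ↔ w ∈ S ∧ f w ∈ e := by simp [trc]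

lemma fin_aux {m : ℕ} (i : Fin (2 * m + 3)) : i + 1 ≠ i - 1 := by
  intro h
  have h2 : (i + 1) + 1 = i := by rw [h]; simp
  have h3 : (1 + 1 : Fin (2 * m + 3)) = 0 := by
    have : i + (1 + 1) = i + 0 := by rw [← add_assoc, h2, add_zero]
    exact add_left_cancel this
  have := congrArg Fin.val h3
  simp [Fin.val_add] at this
  rw [Nat.mod_eq_of_lt (by omega)] at this
  omega

lemma fin_aux1 {m : ℕ} (i : Fin (2 * m + 3)) : i + 1 ≠ i := by
  intro h
  have : i + 1 = i + 0 := by rw [h, add_zero]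
  have := congrArg Fin.val (add_left_cancel this)
  simp at this

/-- no odd cycle of traces of size two -/
lemma no_odd_cycle {E : Finset (Finset V)} (hbal : IsBalanced E) (f : W → V) (S : Finset W)
    (m : ℕ) (w : Fin (2 * m + 3) → W) (hw : Function.Injective w)
    (e : Fin (2 * m + 3) → Finset V) (heE : ∀ i, e i ∈ E)
    (he : ∀ i, trc f S (e i) = {w i, w (i + 1)}) : False := by
  have hS : ∀ i, w i ∈ S := fun i => by
    have : w i ∈ trc f S (e i) := by rw [he]; simp
    exact (mem_trc.1 this).1
  have key : ∀ i j, f (w j) ∈ e i → j = i ∨ j = i + 1 := by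
    intro i j h
    have : w j ∈ trc f S (e i) := mem_trc.2 ⟨hS j, h⟩
    rw [he] at this
    simpa [hw.eq_iff] using this
  have hin : ∀ i, f (w i) ∈ e i ∧ f (w (i + 1)) ∈ e i := by
    intro i
    constructor
    · exact (mem_trc.1 (by rw [he]; simp : w i ∈ trc f S (e i))).2
    · exact (mem_trc.1 (by rw [he]; simp : w (i + 1) ∈ trc f S (e i))).2
  have hfi : Function.Injective (fun i => f (w i)) := by
    intro i j hij
    by_contra hne
    have h1 := key i j (by have := (hin i).1; simp only at hij; rwa [← hij])
    have h2 := key (i - 1) j (by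
      have := (hin (i - 1)).2; simp only [sub_add_cancel] at this hij; rwa [← hij])
    rw [sub_add_cancel] at h2
    have e1 : j = i + 1 := h1.resolve_left (fun h => hne h.symm)
    have e2 : j = i - 1 := h2.resolve_right (fun h => hne h.symm)
    exact fin_aux i (e1.symm.trans e2)
  have hei : Function.Injective e := by
    intro i j hij
    by_contra hne
    have h1 := key j i (by rw [← hij]; exact (hin i).1)
    have h2 := key i j (by rw [hij]; exact (hin j).1)
    have e1 : i = j + 1 := h1.resolve_left hne
    have e2 : j = i + 1 := h2.resolve_left (fun h => hne h.symm)
    have : i - 1 = j := by rw [e1]; simp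
    exact fin_aux i (e2.symm.trans this.symm)
  obtain ⟨t, ht⟩ := hbal m (fun i => f (w i)) e hfi hei heE hin
  have hsub : (Finset.univ.filter fun j => f (w j) ∈ e t) ⊆ {t, t + 1} := by
    intro j hj
    have := key t j (by simpa using hj)
    simpa using this
  have := Finset.card_le_card hsub
  have := Finset.card_le_two (a := t) (b := t + 1)
  omega

/-- the graph of traces of size two -/
def tgraph (E : Finset (Finset V)) (f : W → V) (S : Finset W) : SimpleGraph W where
  Adj x y := x ≠ y ∧ ∃ e ∈ E, trc f S e = {x, y}
  symm := ⟨fun x y h => ⟨h.1.symm, by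
    obtain ⟨e, he, h⟩ := h.2; exact ⟨e, he, by rw [h, Finset.pair_comm]⟩⟩⟩
  loopless := ⟨fun x h => h.1 rfl⟩

/-- the same graph with a vertex isolated -/
def tgraph' (E : Finset (Finset V)) (f : W → V) (S : Finset W) (v : W) : SimpleGraph W where
  Adj x y := (tgraph E f S).Adj x y ∧ x ≠ v ∧ y ≠ v
  symm := ⟨fun x y h => ⟨h.1.symm, h.2.2, h.2.1⟩⟩
  loopless := ⟨fun x h => h.1.1 rfl⟩

lemma tgraph'_reach {E : Finset (Finset V)} {f : W → V} {S : Finset W} {v0 v : W} (hne : v ≠ v0)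
    (hmax : ∀ u, (tgraph E f S).Reachable v0 u →
      (tgraph E f S).dist v0 u ≤ (tgraph E f S).dist v0 v) :
    ∀ d u, (tgraph E f S).Reachable v0 u → (tgraph E f S).dist v0 u = d → u ≠ v →
      (tgraph' E f S v).Reachable v0 u := by
  intro d
  induction d with
  | zero =>
    intro u hr hd _
    rw [hr.dist_eq_zero_iff] at hd
    subst hd
    exact SimpleGraph.Reachable.refl _
  | succ d ih =>
    intro u hr hd hu
    obtain ⟨p, hp⟩ := hr.exists_walk_length_eq_dist
    have hlen : p.length = d + 1 := by omega
    have hadj := p.adj_getVert_succ (i := d) (by omega)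
    have hend : p.getVert (d + 1) = u := by rw [← hlen]; exact p.getVert_length
    rw [hend] at hadj
    have hr' : (tgraph E f S).Reachable v0 (p.getVert d) := ⟨p.take d⟩
    have hle : (tgraph E f S).dist v0 (p.getVert d) ≤ d := by
      refine (SimpleGraph.dist_le (p.take d)).trans ?_
      simp
    have hge : d + 1 ≤ (tgraph E f S).dist v0 (p.getVert d) + 1 := by
      obtain ⟨q, hq⟩ := hr'.exists_walk_length_eq_dist
      have := SimpleGraph.dist_le (q.concat hadj)
      rw [SimpleGraph.Walk.length_concat] at this
      omega
    have hnv : p.getVert d ≠ v := by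
      intro h
      have := hmax u hr
      rw [← h] at this
      omega
    have h1 := ih _ hr' (by omega) hnv
    exact h1.trans (SimpleGraph.Adj.reachable ⟨hadj, hnv, hu⟩)

lemma exists_far [Finite W] (G : SimpleGraph W) (v0 : W) :
    ∃ v, G.Reachable v0 v ∧ ∀ u, G.Reachable v0 u → G.dist v0 u ≤ G.dist v0 v := by
  have hfin : {u | G.Reachable v0 u}.Finite := Set.toFinite _
  obtain ⟨v, hv, h⟩ := Set.exists_max_image _ (fun u => G.dist v0 u) hfin
    ⟨v0, SimpleGraph.Reachable.refl _⟩
  exact ⟨v, hv, h⟩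

/-- bicolorability -/
lemma bicolor [Finite W] {E : Finset (Finset V)} (hbal : IsBalanced E) (f : W → V) :
    ∀ (k : ℕ) (S : Finset W), S.card = k → ∃ c : W → Bool, ∀ e ∈ E, 2 ≤ (trc f S e).card →
      ∀ b, ∃ w ∈ trc f S e, c w = b := by
  intro k
  induction k with
  | zero =>
    intro S hS
    refine ⟨fun _ => true, fun e _ h => ?_⟩
    rw [Finset.card_eq_zero] at hS
    subst hS
    simp [trc] at h
  | succ k ih =>
    intro S hS
    obtain ⟨v0, hv0⟩ : S.Nonempty := Finset.card_pos.1 (by omega)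
    set G := tgraph E f S with hG
    obtain ⟨v, hv, hmax⟩ := exists_far G v0
    have hadjS : ∀ x y, G.Adj x y → x ∈ S := by
      rintro x y ⟨_, e, _, h⟩
      exact (mem_trc.1 (by rw [h]; simp : x ∈ trc f S e)).1
    have hvS : v ∈ S := by
      by_cases h : v = v0
      · rwa [h]
      · obtain ⟨p⟩ := hv.symm
        cases p with
        | nil => exact absurd rfl h
        | cons h' _ => exact hadjS _ _ h'
    obtain ⟨c, hc⟩ := ih (S.erase v) (by rw [Finset.card_erase_of_mem hvS]; omega)
    have htr : ∀ e, v ∉ trc f S e → trc f (S.erase v) e = trc f S e := by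
      intro e he
      ext w
      simp only [mem_trc, Finset.mem_erase] at *
      constructor
      · tauto
      · rintro ⟨h1, h2⟩
        refine ⟨⟨?_, h1⟩, h2⟩
        rintro rfl
        exact he ⟨h1, h2⟩
    have hprop : ∀ x y, (tgraph' E f S v).Adj x y → c x ≠ c y := by
      rintro x y ⟨⟨hxy, e, heE, he⟩, hx, hy⟩ heq
      have h1 : trc f (S.erase v) e = {x, y} := by
        rw [htr, he]
        rw [he]; simp [hx.symm, hy.symm]
      have := hc e heE (by rw [h1, Finset.card_pair hxy]) (!(c x))
      rw [h1] at this
      obtain ⟨w, hw, hw'⟩ := this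
      simp only [Finset.mem_insert, Finset.mem_singleton] at hw
      rcases hw with rfl | rfl
      · simp at hw'
      · rw [heq] at hw'; simp at hw'
    have hnb : ∀ x y, G.Adj v x → G.Adj v y → c x = c y := by
      intro x y hx hy
      by_cases hvv : v = v0
      · exfalso
        subst hvv
        have := hmax x hx.reachable
        rw [SimpleGraph.dist_eq_one_iff_adj.2 hx, SimpleGraph.dist_self] at this
        omega
      by_contra hcxy
      have hrx := tgraph'_reach hvv hmax _ x (hv.trans hx.reachable) rfl hx.ne'
      have hry := tgraph'_reach hvv hmax _ y (hv.trans hy.reachable) rfl hy.ne'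
      obtain ⟨p, hp⟩ := (hrx.symm.trans hry).exists_isPath
      let col : (tgraph' E f S v).Coloring Bool := SimpleGraph.Coloring.mk c (fun {a b} h => hprop a b h)
      have hodd : Odd p.length := by
        rw [col.odd_length_iff_not_congr p]
        change ¬ (c x = true) ↔ (c y = true)
        cases hx' : c x <;> cases hy' : c y <;> simp_all
      obtain ⟨m, hm⟩ := hodd
      have hpv : ∀ i, p.getVert i ≠ v := by
        intro i hi
        by_cases hlt : i < p.length
        · exact (p.adj_getVert_succ hlt).2.1 hi
        · rw [p.getVert_of_length_le (by omega)] at hi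
          exact hy.ne hi.symm
      let w : Fin (2 * m + 3) → W := fun i => if i.val ≤ 2 * m + 1 then p.getVert i.val else v
      have hw : Function.Injective w := by
        intro i j hij
        simp only [w] at hij
        split_ifs at hij with h1 h2 h2
        · exact Fin.ext (hp.getVert_injOn (by simp; omega) (by simp; omega) hij)
        · exact absurd hij (hpv _)
        · exact absurd hij.symm (hpv _)
        · apply Fin.ext; omega
      have hadj : ∀ i, G.Adj (w i) (w (i + 1)) := by
        intro i
        rcases lt_or_ge i.val (2 * m + 1) with h | h
        · have hi : (i + 1).val = i.val + 1 := by
            rw [Fin.val_add_one_of_lt' (by omega)]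
          simp only [w]
          rw [hi, if_pos (by omega), if_pos (by omega)]
          exact (p.adj_getVert_succ (by omega)).1
        · rcases h.eq_or_lt with h | h
          · have hi : (i + 1).val = i.val + 1 := by
              rw [Fin.val_add_one_of_lt' (by omega)]
            simp only [w]
            rw [hi, if_pos (by omega), if_neg (by omega), ← h, ← hm, p.getVert_length]
            exact hy.symm
          · have hi : i = Fin.last _ := Fin.ext (by simp; omega)
            subst hi
            simp only [w, Fin.last_add_one]
            rw [if_neg (by simp), if_pos (by simp)]
            simpa using hx
      choose hne e heE he using hadj
      exact no_odd_cycle hbal f S m w hw e heE he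
    -- the color of the new vertex
    obtain ⟨b0, hb0⟩ : ∃ b0, ∀ x, G.Adj v x → c x ≠ b0 := by
      by_cases h : ∃ x, G.Adj v x
      · obtain ⟨x, hx⟩ := h
        exact ⟨!(c x), fun y hy => by rw [hnb y x hy hx]; simp⟩
      · exact ⟨true, fun x hx => absurd ⟨x, hx⟩ h⟩
    refine ⟨Function.update c v b0, fun e heE hcard b => ?_⟩
    have hback : 2 ≤ (trc f (S.erase v) e).card →
        ∃ w ∈ trc f S e, Function.update c v b0 w = b := by
      intro h
      obtain ⟨w, hw, hwb⟩ := hc e heE h b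
      rw [mem_trc, Finset.mem_erase] at hw
      exact ⟨w, mem_trc.2 ⟨hw.1.2, hw.2⟩, by rw [Function.update_of_ne hw.1.1, hwb]⟩
    by_cases hve : v ∈ trc f S e
    · have her : trc f (S.erase v) e = (trc f S e).erase v := by
        ext w; simp only [mem_trc, Finset.mem_erase]; tauto
      by_cases h3 : 3 ≤ (trc f S e).card
      · exact hback (by rw [her, Finset.card_erase_of_mem hve]; omega)
      · have h1 : ((trc f S e).erase v).card = 1 := by
          rw [Finset.card_erase_of_mem hve]; omega
        obtain ⟨x, hx⟩ := Finset.card_eq_one.1 h1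
        have hex : trc f S e = {v, x} := by rw [← Finset.insert_erase hve, hx]
        have hxv : x ≠ v := by
          have : x ∈ (trc f S e).erase v := by rw [hx]; simp
          exact (Finset.mem_erase.1 this).1
        have := hb0 x ⟨hxv.symm, e, heE, hex⟩
        by_cases hb : b = b0
        · exact ⟨v, hve, by simp [hb]⟩
        · refine ⟨x, by rw [hex]; simp, ?_⟩
          rw [Function.update_of_ne hxv]
          cases hh : c x <;> cases b <;> cases b0 <;> simp_all
    · exact hback (by rw [htr e hve]; exact hcard)

/-- good colorings -/
lemma good_coloring [Fintype W] {E : Finset (Finset V)} (hbal : IsBalanced E) (f : W → V)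
    (s : ℕ) (hs : 1 ≤ s) (hE : ∀ e ∈ E, s ≤ (trc f Finset.univ e).card) :
    ∃ c : W → Fin s, ∀ e ∈ E, ∀ j, ∃ w, f w ∈ e ∧ c w = j := by
  have : NeZero s := ⟨by omega⟩
  obtain ⟨c, -, hc⟩ := Finset.exists_max_image (Finset.univ : Finset (W → Fin s))
    (fun c => ∑ e ∈ E, ((trc f Finset.univ e).image c).card) ⟨fun _ => 0, Finset.mem_univ _⟩
  refine ⟨c, ?_⟩
  by_contra hcon
  push Not at hcon
  obtain ⟨e0, he0, p, hp⟩ := hcon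
  have hp' : p ∉ (trc f Finset.univ e0).image c := by
    intro h
    obtain ⟨w, hw, hwp⟩ := Finset.mem_image.1 h
    exact hp w (mem_trc.1 hw).2 hwp
  have hlt : ((trc f Finset.univ e0).image c).card < (trc f Finset.univ e0).card := by
    refine lt_of_lt_of_le ?_ (hE e0 he0)
    have := Finset.card_lt_univ_of_notMem hp'
    simpa using this
  obtain ⟨x, hx, y, hy, hxy, hcxy⟩ : ∃ x ∈ trc f Finset.univ e0, ∃ y ∈ trc f Finset.univ e0,
      x ≠ y ∧ c x = c y :=
    Finset.exists_ne_map_eq_of_card_lt_of_maps_to hlt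
      (fun a ha => Finset.mem_coe.2 (Finset.mem_image_of_mem c ha))
  set q := c x with hq
  have hpq : p ≠ q := fun h => hp x (mem_trc.1 hx).2 (hq.symm.trans h.symm)
  let S : Finset W := Finset.univ.filter fun w => c w = p ∨ c w = q
  obtain ⟨g, hg⟩ := bicolor hbal f _ S rfl
  let c' : W → Fin s := fun w => if w ∈ S then (if g w then p else q) else c w
  have hS : ∀ w, w ∈ S ↔ c w = p ∨ c w = q := fun w => by simp [S]
  -- colours other than p, q are kept
  have hkeep : ∀ e r, r ≠ p → r ≠ q → r ∈ (trc f Finset.univ e).image c →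
      r ∈ (trc f Finset.univ e).image c' := by
    intro e r h1 h2 hr
    obtain ⟨w, hw, hwr⟩ := Finset.mem_image.1 hr
    refine Finset.mem_image.2 ⟨w, hw, ?_⟩
    have : w ∉ S := by rw [hS, hwr]; tauto
    simp only [c', if_neg this, hwr]
  have htwo : ∀ e ∈ E, 2 ≤ (trc f S e).card → p ∈ (trc f Finset.univ e).image c' ∧
      q ∈ (trc f Finset.univ e).image c' := by
    intro e he h
    constructor
    · obtain ⟨w, hw, hwb⟩ := hg e he h true
      rw [mem_trc] at hw
      exact Finset.mem_image.2 ⟨w, mem_trc.2 ⟨Finset.mem_univ _, hw.2⟩, by simp [c', hw.1, hwb]⟩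
    · obtain ⟨w, hw, hwb⟩ := hg e he h false
      rw [mem_trc] at hw
      exact Finset.mem_image.2 ⟨w, mem_trc.2 ⟨Finset.mem_univ _, hw.2⟩, by simp [c', hw.1, hwb]⟩
  have hsub2 : ∀ e ∈ E, 2 ≤ (trc f S e).card →
      (trc f Finset.univ e).image c ⊆ (trc f Finset.univ e).image c' := by
    intro e he h r hr
    by_cases h1 : r = p
    · rw [h1]; exact (htwo e he h).1
    by_cases h2 : r = q
    · rw [h2]; exact (htwo e he h).2
    exact hkeep e r h1 h2 hr
  have hle : ∀ e ∈ E, ((trc f Finset.univ e).image c).card ≤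
      ((trc f Finset.univ e).image c').card := by
    intro e he
    by_cases h2 : 2 ≤ (trc f S e).card
    · exact Finset.card_le_card (hsub2 e he h2)
    · rcases Nat.eq_zero_or_pos (trc f S e).card with h0 | h0
      · apply Finset.card_le_card
        intro r hr
        obtain ⟨w, hw, hwr⟩ := Finset.mem_image.1 hr
        refine Finset.mem_image.2 ⟨w, hw, ?_⟩
        have : w ∉ S := by
          intro hwS
          have : w ∈ trc f S e := mem_trc.2 ⟨hwS, (mem_trc.1 hw).2⟩
          rw [Finset.card_eq_zero.1 h0] at this
          simp at this
        simp only [c', if_neg this, hwr]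
      · obtain ⟨z, hz⟩ := Finset.card_eq_one.1 (by omega : (trc f S e).card = 1)
        have hzm : z ∈ trc f S e := by rw [hz]; simp
        have hzS := (mem_trc.1 hzm).1
        have hze := (mem_trc.1 hzm).2
        have huniq : ∀ w, w ∈ S → f w ∈ e → w = z := fun w h1 h2 => by
          have : w ∈ trc f S e := mem_trc.2 ⟨h1, h2⟩
          rw [hz] at this
          simpa using this
        have hc'z : c' z = p ∨ c' z = q := by
          simp only [c', if_pos hzS]
          cases g z <;> simp
        have hc'zmem : c' z ∈ (trc f Finset.univ e).image c' :=
          Finset.mem_image_of_mem _ (mem_trc.2 ⟨Finset.mem_univ _, hze⟩)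
        have hsub : (trc f Finset.univ e).image c ⊆
            insert (c z) (((trc f Finset.univ e).image c').erase (c' z)) := by
          intro r hr
          obtain ⟨w, hw, hwr⟩ := Finset.mem_image.1 hr
          by_cases hwS : w ∈ S
          · rw [huniq w hwS (mem_trc.1 hw).2] at hwr
            rw [← hwr]; simp
          · have hr' : r ≠ p ∧ r ≠ q := by
              rw [hS, hwr] at hwS; tauto
            refine Finset.mem_insert_of_mem (Finset.mem_erase.2 ⟨?_, hkeep e r hr'.1 hr'.2 hr⟩)
            rcases hc'z with h | h <;> rw [h]
            · exact hr'.1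
            · exact hr'.2
        refine (Finset.card_le_card hsub).trans ((Finset.card_insert_le _ _).trans ?_)
        rw [Finset.card_erase_of_mem hc'zmem]
        have := Finset.card_pos.2 ⟨_, hc'zmem⟩
        omega
  have hlt0 : ((trc f Finset.univ e0).image c).card <
      ((trc f Finset.univ e0).image c').card := by
    have h2 : 2 ≤ (trc f S e0).card := by
      rw [← Finset.card_pair hxy]
      apply Finset.card_le_card
      intro w hw
      simp only [Finset.mem_insert, Finset.mem_singleton] at hw
      rcases hw with rfl | rfl
      · exact mem_trc.2 ⟨(hS _).2 (Or.inr rfl), (mem_trc.1 hx).2⟩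
      · exact mem_trc.2 ⟨(hS _).2 (Or.inr hcxy.symm), (mem_trc.1 hy).2⟩
    apply Finset.card_lt_card
    refine (Finset.ssubset_iff_of_subset (hsub2 e0 he0 h2)).2 ⟨p, (htwo e0 he0 h2).1, hp'⟩
  have h1 := hc c' (Finset.mem_univ _)
  have h2 := Finset.sum_lt_sum hle ⟨e0, he0, hlt0⟩
  exact absurd h1 (not_le.2 h2)

end Combinatorics

section Algebra

variable {n : ℕ} {K : Type*} [Field K]

lemma pow_support (e : Finset (Fin n)) (s : ℕ) (p : MvPolynomial (Fin n) K)
    (hp : p ∈ (Ideal.span {p : MvPolynomial (Fin n) K | ∃ i ∈ e, p = X i}) ^ s) :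
    ∀ a ∈ p.support, s ≤ ∑ i ∈ e, a i := by
  have hset : {p : MvPolynomial (Fin n) K | ∃ i ∈ e, p = X i} = X '' (e : Set (Fin n)) := by
    ext q; simp [eq_comm]
  rw [hset] at hp
  induction s generalizing p with
  | zero => intro a _; exact Nat.zero_le _
  | succ s ih =>
    rw [pow_succ] at hp
    refine Submodule.mul_induction_on hp ?_ ?_
    · intro q hq r hr a ha
      have := MvPolynomial.support_mul q r ha
      obtain ⟨b, hb, d, hd, rfl⟩ := Finset.mem_add.1 this
      have h1 := ih q hq b hb
      obtain ⟨i, hi, hdi⟩ := MvPolynomial.mem_ideal_span_X_image.1 hr d hd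
      have h2 : d i ≤ ∑ i ∈ e, d i :=
        Finset.single_le_sum (f := fun i => d i) (fun _ _ => Nat.zero_le _) (Finset.mem_coe.1 hi)
      simp only [Finsupp.add_apply, Finset.sum_add_distrib]
      omega
    · intro q r hq hr a ha
      have := MvPolynomial.support_add ha
      rcases Finset.mem_union.1 this with h | h
      · exact hq a h
      · exact hr a h

lemma monomial_mem (E : Finset (Finset (Fin n))) (hbal : IsBalanced E) (s : ℕ) (hs : 1 ≤ s)
    (a : Fin n →₀ ℕ) (ha : ∀ e ∈ E, s ≤ ∑ i ∈ e, a i) :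
    (monomial a (1 : K)) ∈ (coverIdeal K E) ^ s := by
  let W := Σ i : Fin n, Fin (a i)
  let f : W → Fin n := Sigma.fst
  have hE : ∀ e ∈ E, s ≤ (trc f Finset.univ e).card := by
    intro e he
    refine (ha e he).trans (le_of_eq ?_)
    have : trc f Finset.univ e = e.sigma (fun i => (Finset.univ : Finset (Fin (a i)))) := by
      ext w; rw [mem_trc, Finset.mem_sigma]; simp [f]
    rw [this, Finset.card_sigma]
    simp
  obtain ⟨c, hc⟩ := good_coloring hbal f s hs hE
  have hprod : (monomial a (1 : K)) = ∏ j : Fin s, ∏ w : W with c w = j, X (f w) := by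
    rw [Finset.prod_fiberwise, Fintype.prod_sigma, MvPolynomial.monomial_eq,
      Finsupp.prod_fintype _ _ (by simp)]
    simp [f]
  rw [hprod]
  have : ∏ j : Fin s, (coverIdeal K E) = (coverIdeal K E) ^ s := by simp
  rw [← this]
  refine Ideal.prod_mem_prod fun j _ => ?_
  simp only [coverIdeal, Submodule.mem_iInf]
  intro e he
  obtain ⟨w, hw, hwj⟩ := hc e he j
  refine Ideal.mem_of_dvd _ (Finset.dvd_prod_of_mem (fun w => X (f w)) (a := w) ?_)
    (Ideal.subset_span ⟨f w, hw, rfl⟩)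
  simp [hwj]

end Algebra

/-- The cover ideal of a balanced hypergraph is normally torsion-free:
`J(H)^s = J(H)^{(s)}` for all `s ≥ 1`. -/
theorem coverIdeal_normally_torsionFree_of_balanced {n : ℕ} (K : Type*) [Field K]
    (E : Finset (Finset (Fin n))) (hbal : IsBalanced E) :
    ∀ s : ℕ, 1 ≤ s → (coverIdeal K E) ^ s = coverIdealSymbPow K E s := by
  intro s hs
  apply le_antisymm
  · refine le_iInf₂ fun e he => ?_
    exact Ideal.pow_right_mono (iInf₂_le e he) s
  · intro p hp
    have hp' : ∀ e ∈ E, p ∈ (Ideal.span {p : MvPolynomial (Fin n) K | ∃ i ∈ e, p = X i}) ^ s := by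
      simpa only [coverIdealSymbPow, Submodule.mem_iInf] using hp
    rw [p.as_sum]
    refine Ideal.sum_mem _ fun a ha => ?_
    have hm := monomial_mem (K := K) E hbal s hs a (fun e he => pow_support e s p (hp' e he) a ha)
    have := Ideal.mul_mem_left _ (C (coeff a p)) hm
    rwa [C_mul_monomial, mul_one] at this
end

section
/- Let H be a balanced hypergraph on {1,...,n} with cover ideal J(H) ⊆ R = K[x_1,...,x_n]. Then for every t ≥ 1, depth R/J(H)^t ≥ depth R/J(H)^{t+1}; that is, the depth function t ↦ depth R/J(H)^t is non-increasing. -/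
open MvPolynomial

/-- The depth of `R/I` with respect to the maximal homogeneous ideal `m = (x_1,…,x_n)`:
the supremum of the lengths of regular sequences on `R/I` consisting of elements of `m`. -/
noncomputable def quotDepth {n : ℕ} (K : Type*) [Field K]
    (I : Ideal (MvPolynomial (Fin n) K)) : ℕ :=
  sSup {k : ℕ | ∃ rs : List (MvPolynomial (Fin n) K), rs.length = k ∧
    (∀ r ∈ rs, r ∈ Ideal.span (Set.range (X : Fin n → MvPolynomial (Fin n) K))) ∧
    RingTheory.Sequence.IsRegular (MvPolynomial (Fin n) K ⧸ I) rs}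

/-! ### Part 1: good colourings of balanced hypergraphs -/

/-- A closed walk of length `l`, as a sequence. -/
def IsLoopSeq {W : Type*} (r : W → W → Prop) (l : ℕ) (v : ℕ → W) : Prop :=
  v l = v 0 ∧ ∀ i < l, r (v i) (v (i + 1))

theorem exists_min_odd_loop {W : Type*} (r : W → W → Prop) (l : ℕ) (hl : Odd l) (v : ℕ → W)
    (hv : IsLoopSeq r l v) :
    ∃ l, Odd l ∧ ∃ v, IsLoopSeq r l v ∧ ∀ i j, i < j → j < l → v i ≠ v j := by
  classical
  have hex : ∃ l, Odd l ∧ ∃ v, IsLoopSeq r l v := ⟨l, hl, v, hv⟩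
  obtain ⟨hodd, v, hv⟩ := Nat.find_spec hex
  refine ⟨Nat.find hex, hodd, v, hv, ?_⟩
  intro i j hij hj heq
  have hmin := fun m hm => Nat.find_min hex (m := m) hm
  generalize Nat.find hex = L at *
  rcases Nat.even_or_odd (j - i) with h | h
  · refine hmin (L - (j - i)) (by omega) ⟨?_, fun k => if k ≤ i then v k else v (k + (j - i)), ?_, ?_⟩
    · grind
    · have h1 : ¬ (L - (j - i) ≤ i) := by omega
      have h2 : L - (j - i) + (j - i) = L := by omega
      simp only [h1, if_false, h2, Nat.zero_le, if_true]
      exact hv.1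
    · intro k hk
      rcases lt_trichotomy k i with h1 | h1 | h1
      · have h2 : k ≤ i := by omega
        have h3 : k + 1 ≤ i := by omega
        simp only [h2, h3, if_true]
        exact hv.2 k (by omega)
      · subst h1
        have h3 : ¬ (k + 1 ≤ k) := by omega
        have h4 : k + 1 + (j - k) = j + 1 := by omega
        simp only [h3, if_false, le_refl, if_true, heq, h4]
        exact hv.2 j (by omega)
      · have h2 : ¬ k ≤ i := by omega
        have h3 : ¬ k + 1 ≤ i := by omega
        have h4 : k + 1 + (j - i) = k + (j - i) + 1 := by omega
        simp only [h2, h3, if_false, h4]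
        exact hv.2 _ (by omega)
  · refine hmin (j - i) (by omega) ⟨h, fun k => v (i + k), ?_, ?_⟩
    · have : i + (j - i) = j := by omega
      simp only [this, Nat.add_zero]
      exact heq.symm
    · intro k hk
      exact hv.2 (i + k) (by omega)

theorem two_color {V W : Type*} [DecidableEq V] [DecidableEq W] [Fintype W]
    (π : W → V) (E : Finset (Finset V)) (hbal : IsBalanced E) (A : Finset W) :
    ∃ c : W → Bool, ∀ e ∈ E, 2 ≤ (A.filter (fun w => π w ∈ e)).card →
      ∀ b : Bool, ∃ w ∈ A, π w ∈ e ∧ c w = b := by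
  classical
  induction A using Finset.strongInduction with
  | H A ih =>
  rcases A.eq_empty_or_nonempty with rfl | ⟨x0, hx0⟩
  · exact ⟨fun _ => true, by simp⟩
  let G : SimpleGraph W :=
    { Adj := fun v w => v ≠ w ∧ ∃ e ∈ E, A.filter (fun u => π u ∈ e) = {v, w}
      symm := ⟨by
        rintro v w ⟨h, e, he, h2⟩
        exact ⟨h.symm, e, he, by rw [h2, Finset.pair_comm]⟩⟩
      loopless := ⟨by
        rintro v ⟨h, -⟩
        exact h rfl⟩ }
  have hcol : G.Colorable 2 := by
    rw [SimpleGraph.two_colorable_iff_forall_loop_even]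
    intro u w
    by_contra hodd
    rw [Nat.not_even_iff_odd] at hodd
    obtain ⟨l, hl, v, ⟨hv0, hv⟩, hinj⟩ := exists_min_odd_loop G.Adj w.length hodd w.getVert
      ⟨by simp, fun i hi => w.adj_getVert_succ hi⟩
    obtain ⟨m, rfl⟩ : ∃ m, l = 2 * m + 3 := by
      obtain ⟨k, rfl⟩ := hl
      rcases k with _ | m
      · have := hv 0 (by omega)
        simp only [Nat.mul_zero, Nat.zero_add] at hv0 this
        rw [hv0] at this
        exact (G.loopless.irrefl _ this).elim
      · exact ⟨m, by ring⟩
    have hsucc : ∀ i : Fin (2 * m + 3), v ((i + 1 : Fin (2 * m + 3)) : ℕ) = v (i.val + 1) := by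
      intro i
      rw [Fin.val_add_one]
      split_ifs with h
      · subst h
        rw [← hv0]; rfl
      · rfl
    let v' : Fin (2 * m + 3) → W := fun i => v i
    have hinj' : Function.Injective v' := by
      intro i j hij
      by_contra hne
      rcases lt_or_gt_of_ne hne with h | h
      · exact hinj i j h j.2 hij
      · exact hinj j i h i.2 hij.symm
    have hadj : ∀ i, ∃ e ∈ E, A.filter (fun u => π u ∈ e) = {v' i, v' (i + 1)} := by
      intro i
      have := (hv i i.2).2
      rw [← hsucc] at this
      exact this
    choose e heE he using hadj
    have hmem : ∀ i w, (w ∈ A ∧ π w ∈ e i) ↔ (w = v' i ∨ w = v' (i + 1)) := by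
      intro i w
      have := congrArg (fun s => w ∈ s) (he i)
      simpa using this
    have hA : ∀ i, v' i ∈ A := fun i => ((hmem i _).2 (Or.inl rfl)).1
    have hin : ∀ i, π (v' i) ∈ e i := fun i => ((hmem i _).2 (Or.inl rfl)).2
    have hin' : ∀ i, π (v' (i + 1)) ∈ e i := fun i => ((hmem i _).2 (Or.inr rfl)).2
    have honly : ∀ i j, π (v' j) ∈ e i → j = i ∨ j = i + 1 := by
      intro i j h
      rcases (hmem i _).1 ⟨hA j, h⟩ with h | h
      · exact Or.inl (hinj' h)
      · exact Or.inr (hinj' h)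
    have h1 : ∀ i : Fin (2 * m + 3), i + 1 + 1 ≠ i := by
      intro i h
      have h2 : (1 + 1 : Fin (2 * m + 3)) = 0 := by
        have : i + (1 + 1) = i + 0 := by rw [← add_assoc, h, add_zero]
        exact add_left_cancel this
      have h3 := congrArg Fin.val h2
      simp [Fin.val_add] at h3
      rw [Nat.mod_eq_of_lt (by omega)] at h3
      omega
    have h10 : ∀ i : Fin (2 * m + 3), i + 1 ≠ i := by
      intro i h
      have h2 : (1 : Fin (2 * m + 3)) = 0 := by
        have : i + 1 = i + 0 := by rw [h, add_zero]
        exact add_left_cancel this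
      have h3 := congrArg Fin.val h2
      simp at h3
    have hpi : Function.Injective (fun i => π (v' i)) := by
      intro i j hij
      simp only at hij
      by_contra hne
      -- `j = i + 1` and `i = j + 1`
      have a := honly i j (hij ▸ hin i)
      have b := honly j i (hij.symm ▸ hin j)
      have a' : j = i + 1 := a.resolve_left (fun h => hne h.symm)
      have b' : i = j + 1 := b.resolve_left hne
      rw [a'] at b'
      exact h1 i b'.symm
    have hei : Function.Injective e := by
      intro i j hij
      by_contra hne
      have a := (honly j i (hij ▸ hin i)).resolve_left hne
      have b := (honly i j (hij.symm ▸ hin j)).resolve_left (fun h => hne h.symm)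
      rw [a] at b
      exact h1 j b.symm
    obtain ⟨t, ht⟩ := hbal m (fun i => π (v' i)) e hpi hei heE (fun i => ⟨hin i, hin' i⟩)
    have : (Finset.univ.filter fun j => π (v' j) ∈ e t) ⊆ {t, t + 1} := by
      intro j hj
      simp only [Finset.mem_filter, Finset.mem_univ, true_and] at hj
      simpa using honly t j hj
    have := (Finset.card_le_card this).trans Finset.card_le_two
    omega
  obtain ⟨C⟩ := hcol
  let c : W → Bool := fun w => decide (C w = 0)
  have hc : ∀ v w, G.Adj v w → c v ≠ c w := by
    intro v w h
    have := C.valid h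
    simp only [c, ne_eq, decide_eq_decide]
    generalize C v = a at *
    generalize C w = b at *
    revert this
    revert a b
    decide
  -- farthest vertex
  obtain ⟨x, hx, hmax⟩ := Finset.exists_max_image
    (A.filter (fun w => G.Reachable x0 w)) (fun w => G.dist x0 w)
    ⟨x0, by simp [hx0]⟩
  simp only [Finset.mem_filter] at hx hmax
  obtain ⟨hxA, hxr⟩ := hx
  have hAdjA : ∀ v w, G.Adj v w → v ∈ A ∧ w ∈ A := by
    rintro v w ⟨-, e, -, h⟩
    constructor
    · have : v ∈ A.filter (fun u => π u ∈ e) := by rw [h]; simp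
      exact (Finset.mem_filter.1 this).1
    · have : w ∈ A.filter (fun u => π u ∈ e) := by rw [h]; simp
      exact (Finset.mem_filter.1 this).1
  obtain ⟨S, hS⟩ := ih (A.erase x) (Finset.erase_ssubset hxA)
  have hfil : ∀ e : Finset V, (A.erase x).filter (fun w => π w ∈ e) = (A.filter (fun w => π w ∈ e)).erase x := by
    intro e; ext w; simp; tauto
  have hSadj : ∀ v w, G.Adj v w → v ≠ x → w ≠ x → S v ≠ S w := by
    rintro v w ⟨hne, e, he, h⟩ hv hw heq
    have hh : (A.erase x).filter (fun w => π w ∈ e) = {v, w} := by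
      rw [hfil, h, Finset.erase_eq_of_notMem]
      simp [hv.symm, hw.symm]
    have h2 := hS e he (by rw [hh, Finset.card_pair hne])
    obtain ⟨u, hu, hue, huc⟩ := h2 (!(S v))
    have : u ∈ (A.erase x).filter (fun w => π w ∈ e) := Finset.mem_filter.2 ⟨hu, hue⟩
    rw [hh] at this
    simp only [Finset.mem_insert, Finset.mem_singleton] at this
    rcases this with rfl | rfl
    · simp at huc
    · simp [heq] at huc
  have hkey : ∀ d y, G.Reachable x0 y → G.dist x0 y = d → y ≠ x → x0 ≠ x →
      xor (S y) (c y) = xor (S x0) (c x0) := by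
    intro d
    induction d with
    | zero =>
      intro y hy hd _ _
      rw [hy.dist_eq_zero_iff] at hd
      rw [hd]
    | succ d ihd =>
      intro y hy hd hyx hx0x
      obtain ⟨p, hp⟩ := hy.exists_walk_length_eq_dist
      rw [hd] at hp
      let z := p.getVert d
      have hzy : G.Adj z y := by
        have := p.adj_getVert_succ (i := d) (by omega)
        rwa [← hp, p.getVert_length] at this
      have hz : G.Reachable x0 z := hy.trans hzy.symm.reachable
      have hzd : G.dist x0 z ≤ d := by
        have h1 := SimpleGraph.dist_le (p.take d)
        have h2 : (p.take d).length = d := by simp [SimpleGraph.Walk.take_length]; omega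
        rw [h2] at h1
        exact h1
      have hzd' : G.dist x0 z = d := by
        obtain ⟨q, hq⟩ := hz.exists_walk_length_eq_dist
        have h1 := SimpleGraph.dist_le (q.concat hzy)
        rw [SimpleGraph.Walk.length_concat] at h1
        omega
      have hzx : z ≠ x := by
        intro h
        have := hmax y ⟨(hAdjA _ _ hzy).2, hy⟩
        rw [← h] at this
        omega
      have h1 := ihd z hz hzd' hzx hx0x
      have h2 := hSadj z y hzy hzx hyx
      have h3 := hc z y hzy
      rw [← h1]
      generalize S z = a at *
      generalize S y = b at *
      generalize c z = a' at *
      generalize c y = b' at *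
      revert h2 h3
      clear * -
      revert a b a' b'
      decide
  refine ⟨Function.update S x (xor (xor (S x0) (c x0)) (c x)), ?_⟩
  intro e he hcard b
  by_cases hxe : π x ∈ e
  · by_cases h3 : 2 ≤ ((A.erase x).filter (fun w => π w ∈ e)).card
    · obtain ⟨w, hw, hwe, hwc⟩ := hS e he h3 b
      refine ⟨w, Finset.mem_of_mem_erase hw, hwe, ?_⟩
      rw [Function.update_of_ne (Finset.ne_of_mem_erase hw), hwc]
    · have hxm : x ∈ A.filter (fun w => π w ∈ e) := Finset.mem_filter.2 ⟨hxA, hxe⟩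
      rw [hfil, Finset.card_erase_of_mem hxm] at h3
      have h2 : (A.filter (fun w => π w ∈ e)).card = 2 := by omega
      have h4 : ((A.filter (fun w => π w ∈ e)).erase x).card = 1 := by
        rw [Finset.card_erase_of_mem hxm]; omega
      obtain ⟨y, hy⟩ := Finset.card_eq_one.1 h4
      have hyne : y ≠ x := by
        have : y ∈ (A.filter (fun w => π w ∈ e)).erase x := by rw [hy]; simp
        exact Finset.ne_of_mem_erase this
      have hpair : A.filter (fun w => π w ∈ e) = {x, y} := by
        rw [← Finset.insert_erase hxm, hy]
      have hadj : G.Adj x y := ⟨hyne.symm, e, he, hpair⟩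
      have hye : y ∈ A ∧ π y ∈ e := by
        have : y ∈ A.filter (fun w => π w ∈ e) := by rw [hpair]; simp
        simpa using this
      have hyr : G.Reachable x0 y := hxr.trans hadj.reachable
      have hx0x : x0 ≠ x := by
        rintro rfl
        have := hmax y ⟨hye.1, hyr⟩
        rw [SimpleGraph.dist_self] at this
        have h0 : G.dist x0 y = 0 := by omega
        rw [hyr.dist_eq_zero_iff] at h0
        exact hyne h0.symm
      have h5 := hkey _ y hyr rfl hyne hx0x
      have h6 := hc x y hadj
      by_cases hb : S y = b
      · exact ⟨y, hye.1, hye.2, by rw [Function.update_of_ne hyne, hb]⟩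
      · refine ⟨x, hxA, hxe, ?_⟩
        rw [Function.update_self, ← h5]
        generalize S y = a at *
        generalize c x = a' at *
        generalize c y = b' at *
        revert hb h6
        clear * -
        revert a b a' b'
        decide
  · rw [← Finset.erase_eq_of_notMem (a := x) (s := A.filter (fun w => π w ∈ e)) (by simp [hxe]),
      ← hfil] at hcard
    obtain ⟨w, hw, hwe, hwc⟩ := hS e he hcard b
    refine ⟨w, Finset.mem_of_mem_erase hw, hwe, ?_⟩
    rw [Function.update_of_ne (Finset.ne_of_mem_erase hw), hwc]

theorem good_coloring_s13 {V W : Type*} [DecidableEq V] [DecidableEq W] [Fintype W]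
    (π : W → V) (E : Finset (Finset V)) (hbal : IsBalanced E) (t : ℕ) (ht : 1 ≤ t) :
    ∃ c : W → Fin t, ∀ e ∈ E,
      min (Finset.univ.filter (fun w => π w ∈ e)).card t ≤
        ((Finset.univ.filter (fun w => π w ∈ e)).image c).card := by
  classical
  have : Nonempty (Fin t) := ⟨⟨0, ht⟩⟩
  obtain ⟨c, hc⟩ := Finite.exists_max (fun c : W → Fin t =>
    ∑ e ∈ E, ((Finset.univ.filter (fun w => π w ∈ e)).image c).card)
  refine ⟨c, fun e he => ?_⟩
  by_contra hlt
  rw [not_le, lt_min_iff] at hlt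
  obtain ⟨h1, h2⟩ := hlt
  obtain ⟨w1, hw1, w2, hw2, hne, heq⟩ := Finset.exists_ne_map_eq_of_card_lt_of_maps_to
    (t := (Finset.univ.filter (fun w => π w ∈ e)).image c) (f := c) h1
    (fun w hw => Finset.mem_image_of_mem c hw)
  obtain ⟨q, hq⟩ : ∃ q, q ∉ (Finset.univ.filter (fun w => π w ∈ e)).image c := by
    by_contra hall
    push Not at hall
    have := Finset.eq_univ_iff_forall.2 hall
    rw [this] at h2
    simp at h2
  let p := c w1
  let A : Finset W := Finset.univ.filter (fun w => c w = p ∨ c w = q)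
  obtain ⟨s, hs⟩ := two_color π E hbal A
  let c' : W → Fin t := fun w => if w ∈ A then (if s w then p else q) else c w
  have hc'A : ∀ w ∈ A, c' w = if s w then p else q := fun w hw => if_pos hw
  have hc'n : ∀ w, w ∉ A → c' w = c w := fun w hw => if_neg hw
  have hmemA : ∀ w, w ∈ A ↔ (c w = p ∨ c w = q) := fun w => by simp [A]
  have hbig : ∀ e' ∈ E, 2 ≤ (A.filter (fun w => π w ∈ e')).card →
      (p ∈ (Finset.univ.filter (fun w => π w ∈ e')).image c' ∧
      q ∈ (Finset.univ.filter (fun w => π w ∈ e')).image c') ∧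
      (Finset.univ.filter (fun w => π w ∈ e')).image c ⊆
        (Finset.univ.filter (fun w => π w ∈ e')).image c' := by
    intro e' he' h
    have hp : p ∈ (Finset.univ.filter (fun w => π w ∈ e')).image c' := by
      obtain ⟨w, hw, hwe, hws⟩ := hs e' he' h true
      exact Finset.mem_image.2 ⟨w, by simpa using hwe, by rw [hc'A w hw, hws]; rfl⟩
    have hq' : q ∈ (Finset.univ.filter (fun w => π w ∈ e')).image c' := by
      obtain ⟨w, hw, hwe, hws⟩ := hs e' he' h false
      exact Finset.mem_image.2 ⟨w, by simpa using hwe, by rw [hc'A w hw, hws]; rfl⟩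
    refine ⟨⟨hp, hq'⟩, ?_⟩
    intro a ha
    obtain ⟨w, hw, rfl⟩ := Finset.mem_image.1 ha
    by_cases hwA : w ∈ A
    · rcases (hmemA w).1 hwA with h | h
      · rw [h]; exact hp
      · rw [h]; exact hq'
    · rw [← hc'n w hwA]
      exact Finset.mem_image_of_mem _ hw
  have hle : ∀ e' ∈ E, ((Finset.univ.filter (fun w => π w ∈ e')).image c).card ≤
      ((Finset.univ.filter (fun w => π w ∈ e')).image c').card := by
    intro e' he'
    by_cases h : 2 ≤ (A.filter (fun w => π w ∈ e')).card
    · exact Finset.card_le_card (hbig e' he' h).2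
    · have h' : (A.filter (fun w => π w ∈ e')).card ≤ 1 := by omega
      rw [Finset.card_le_one] at h'
      by_cases hex : ∃ w ∈ A, π w ∈ e'
      · obtain ⟨w, hw, hwe⟩ := hex
        set D := (Finset.univ.filter (fun w => π w ∈ e')).erase w with hD
        have hins : Finset.univ.filter (fun w => π w ∈ e') = insert w D := by
          rw [hD, Finset.insert_erase]; simpa using hwe
        have hDA : ∀ u ∈ D, u ∉ A := by
          intro u hu huA
          have hu' := Finset.mem_erase.1 hu
          apply hu'.1
          refine h' u ?_ w ?_
          · exact Finset.mem_filter.2 ⟨huA, (Finset.mem_filter.1 hu'.2).2⟩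
          · exact Finset.mem_filter.2 ⟨hw, hwe⟩
        have himg : D.image c' = D.image c :=
          Finset.image_congr (fun u hu => hc'n u (hDA u hu))
        have hno : ∀ a, (a = p ∨ a = q) → a ∉ D.image c := by
          intro a ha hin
          obtain ⟨u, hu, rfl⟩ := Finset.mem_image.1 hin
          exact hDA u hu ((hmemA u).2 ha)
        rw [hins, Finset.image_insert, Finset.image_insert, himg,
          Finset.card_insert_of_notMem (hno _ ((hmemA w).1 hw)),
          Finset.card_insert_of_notMem]
        apply hno
        rw [hc'A w hw]
        split_ifs <;> simp
      · push Not at hex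
        apply le_of_eq
        congr 1
        apply Finset.image_congr
        intro u hu
        refine (hc'n u (fun huA => hex u huA ?_)).symm
        simpa using hu
  have hA2 : 2 ≤ (A.filter (fun w => π w ∈ e)).card := by
    have : ({w1, w2} : Finset W) ⊆ A.filter (fun w => π w ∈ e) := by
      intro w hw
      simp only [Finset.mem_insert, Finset.mem_singleton] at hw
      rcases hw with rfl | rfl
      · exact Finset.mem_filter.2 ⟨(hmemA _).2 (Or.inl rfl), (Finset.mem_filter.1 hw1).2⟩
      · exact Finset.mem_filter.2 ⟨(hmemA _).2 (Or.inl heq.symm), (Finset.mem_filter.1 hw2).2⟩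
    have h3 := Finset.card_le_card this
    rwa [Finset.card_pair hne] at h3
  have hlt : ((Finset.univ.filter (fun w => π w ∈ e)).image c).card <
      ((Finset.univ.filter (fun w => π w ∈ e)).image c').card := by
    apply Finset.card_lt_card
    have := hbig e he hA2
    exact ⟨this.2, fun h => hq (h this.1.2)⟩
  have := Finset.sum_lt_sum hle ⟨e, he, hlt⟩
  exact absurd (hc c') (not_le.2 this)

/-- Decomposition of an integer weight along a good colouring. -/
theorem weight_decomposition {V : Type*} [DecidableEq V] [Fintype V]
    (E : Finset (Finset V)) (hbal : IsBalanced E) (t : ℕ) (ht : 1 ≤ t) (α : V → ℕ) :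
    ∃ C : Fin t → V → ℕ, (∀ v, ∑ j, C j v = α v) ∧
      ∀ e ∈ E, ∀ j, (t ≤ ∑ v ∈ e, α v → 1 ≤ ∑ v ∈ e, C j v) ∧
        (∑ v ∈ e, α v ≤ t → ∑ v ∈ e, C j v ≤ 1) := by
  classical
  obtain ⟨c, hc⟩ := good_coloring_s13 (W := Σ v : V, Fin (α v)) (fun w => w.1) E hbal t ht
  refine ⟨fun j v => (Finset.univ.filter (fun i : Fin (α v) => c ⟨v, i⟩ = j)).card, ?_, ?_⟩
  · intro v
    have := Finset.card_eq_sum_card_fiberwise (f := fun i : Fin (α v) => c ⟨v, i⟩)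
      (s := Finset.univ) (t := Finset.univ) (by simp)
    simpa using this.symm
  · intro e he j
    have hW : Finset.univ.filter (fun w : (Σ v : V, Fin (α v)) => w.1 ∈ e) = e.sigma (fun v => Finset.univ) := by
      ext ⟨v, i⟩; simp
    have hcard : (Finset.univ.filter (fun w : (Σ v : V, Fin (α v)) => w.1 ∈ e)).card = ∑ v ∈ e, α v := by
      rw [hW, Finset.card_sigma]; simp
    have hcj : ((Finset.univ.filter (fun w : (Σ v : V, Fin (α v)) => w.1 ∈ e)).filter (fun w => c w = j)).card =
        ∑ v ∈ e, (Finset.univ.filter (fun i : Fin (α v) => c ⟨v, i⟩ = j)).card := by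
      rw [← Finset.card_sigma]
      congr 1
      ext ⟨v, i⟩; simp
    have hg := hc e he
    rw [hcard] at hg
    rw [← hcj]
    constructor
    · intro h
      rw [min_eq_right h] at hg
      have huniv : (Finset.univ.filter (fun w : (Σ v : V, Fin (α v)) => w.1 ∈ e)).image c = Finset.univ := by
        apply Finset.eq_univ_of_card
        apply le_antisymm (Finset.card_le_univ _)
        simpa using hg
      have hj : j ∈ (Finset.univ.filter (fun w : (Σ v : V, Fin (α v)) => w.1 ∈ e)).image c := by
        rw [huniv]; simp
      obtain ⟨w, hw, hwj⟩ := Finset.mem_image.1 hj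
      exact Finset.card_pos.2 ⟨w, Finset.mem_filter.2 ⟨hw, hwj⟩⟩
    · intro h
      rw [min_eq_left h] at hg
      have hinj : Set.InjOn c (Finset.univ.filter (fun w : (Σ v : V, Fin (α v)) => w.1 ∈ e)) := by
        apply Finset.card_image_iff.1
        apply le_antisymm Finset.card_image_le
        rw [hcard]; exact hg
      rw [Finset.card_le_one]
      intro a ha b hb
      rw [Finset.mem_filter] at ha hb
      exact hinj ha.1 hb.1 (ha.2.trans hb.2.symm)

/-! ### Part 2: an elementary theory of depth for cyclic modules -/

/-- `r` is a non-zero-divisor on `B / N`. -/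
def RegOn {B : Type*} [CommRing B] (N : Ideal B) (r : B) : Prop :=
  ∀ m, r * m ∈ N → m ∈ N

/-- There is a weakly regular sequence of length `k` on `B / N` with entries in `T`. -/
def DepthGE {B : Type*} [CommRing B] (T : Set B) : ℕ → Ideal B → Prop
  | 0, _ => True
  | k + 1, N => ∃ r ∈ T, RegOn N r ∧ DepthGE T k (N ⊔ Ideal.span {r})

theorem mem_sup_span {B : Type*} [CommRing B] (N : Ideal B) (r b : B) :
    b ∈ N ⊔ Ideal.span {r} ↔ ∃ c, b - r * c ∈ N := by
  rw [Submodule.mem_sup]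
  constructor
  · rintro ⟨y, hy, z, hz, rfl⟩
    obtain ⟨c, rfl⟩ := Ideal.mem_span_singleton'.1 hz
    exact ⟨c, by rw [mul_comm r c, add_sub_cancel_right]; exact hy⟩
  · rintro ⟨c, hc⟩
    exact ⟨_, hc, r * c, Ideal.mul_mem_right _ _ (Ideal.mem_span_singleton_self r), by ring⟩

theorem DepthGE.mono {B : Type*} [CommRing B] {T T' : Set B} (h : T ⊆ T') :
    ∀ (k : ℕ) (N : Ideal B), DepthGE T k N → DepthGE T' k N
  | 0, _, _ => trivial
  | k + 1, _, ⟨r, hr, hreg, hd⟩ => ⟨r, h hr, hreg, DepthGE.mono h k _ hd⟩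

theorem DepthGE.pred {B : Type*} [CommRing B] {T : Set B} :
    ∀ (k : ℕ) (N : Ideal B), DepthGE T (k + 1) N → DepthGE T k N
  | 0, _, _ => trivial
  | k + 1, _, ⟨r, hr, hreg, hd⟩ => ⟨r, hr, hreg, DepthGE.pred k _ hd⟩

/-- Finitely many primes control zero divisors on `B / N`. -/
theorem exists_primes {B : Type*} [CommRing B] [IsNoetherianRing B] (N : Ideal B) :
    ∃ s : Set (Ideal B), s.Finite ∧ (∀ P ∈ s, P.IsPrime) ∧
      (∀ r, (∀ P ∈ s, r ∉ P) ↔ RegOn N r) ∧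
      (∀ P ∈ s, ∃ x, x ∉ N ∧ ∀ p ∈ P, p * x ∈ N) := by
  refine ⟨associatedPrimes B (B ⧸ N), associatedPrimes.finite B (B ⧸ N),
    fun P hP => IsAssociatedPrime.isPrime hP, ?_, ?_⟩
  · intro r
    have h := biUnion_associatedPrimes_eq_zero_divisors B (B ⧸ N)
    have h2 := Set.ext_iff.1 h r
    simp only [Set.mem_iUnion, SetLike.mem_coe, exists_prop, Set.mem_ofPred_eq] at h2
    constructor
    · intro h3 m hm
      by_contra hmN
      obtain ⟨P, hP, hr⟩ := h2.2 ⟨Ideal.Quotient.mk N m, by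
        rwa [Ne, Ideal.Quotient.eq_zero_iff_mem], by
        have : r • (Ideal.Quotient.mk N m) = Ideal.Quotient.mk N (r * m) := rfl
        rw [this, Ideal.Quotient.eq_zero_iff_mem]; exact hm⟩
      exact h3 P hP hr
    · intro h3 P hP hr
      obtain ⟨x, hx, hrx⟩ := h2.1 ⟨P, hP, hr⟩
      obtain ⟨m, rfl⟩ := Ideal.Quotient.mk_surjective x
      have : r • (Ideal.Quotient.mk N m) = Ideal.Quotient.mk N (r * m) := rfl
      rw [this, Ideal.Quotient.eq_zero_iff_mem] at hrx
      rw [Ne, Ideal.Quotient.eq_zero_iff_mem] at hx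
      exact hx (h3 m hrx)
  · intro P hP
    rw [AssociatedPrimes.mem_iff, isAssociatedPrime_iff] at hP
    obtain ⟨hprime, x, rfl⟩ := hP
    obtain ⟨m, rfl⟩ := Ideal.Quotient.mk_surjective x
    refine ⟨m, ?_, ?_⟩
    · intro hm
      apply hprime.ne_top
      rw [Ideal.Quotient.eq_zero_iff_mem.2 hm]
      simp
    · intro p hp
      rw [Submodule.mem_colon_singleton] at hp
      have : p • (Ideal.Quotient.mk N m) = Ideal.Quotient.mk N (p * m) := rfl
      rw [this, Submodule.mem_bot, Ideal.Quotient.eq_zero_iff_mem] at hp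
      exact hp

/-- Prime avoidance: a common regular element inside the image of an ideal, for finitely many cyclic modules. -/
theorem exists_common_regular {A B ι : Type*} [CommRing A] [CommRing B] [IsNoetherianRing B]
    [Finite ι] (φ : A →+* B) (𝔞 : Ideal A) (N : ι → Ideal B)
    (h : ∀ j x, (∀ a ∈ 𝔞, φ a * x ∈ N j) → x ∈ N j) :
    ∃ a ∈ 𝔞, ∀ j, RegOn (N j) (φ a) := by
  choose s hfin hprime hreg hann using fun j => exists_primes (N j)
  by_contra hcon
  push Not at hcon
  have hfin' : (⋃ j, s j).Finite := Set.finite_iUnion hfin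
  have hsub : (𝔞 : Set A) ⊆ ⋃ P ∈ (⋃ j, s j), ((P.comap φ : Ideal A) : Set A) := by
    intro a ha
    obtain ⟨j, hj⟩ := hcon a ha
    rw [← hreg] at hj
    push Not at hj
    obtain ⟨P, hP, haP⟩ := hj
    simp only [Set.mem_iUnion]
    exact ⟨P, ⟨j, hP⟩, haP⟩
  obtain ⟨P, hP, hle⟩ := (Ideal.subset_union_prime_finite hfin'
    (f := fun P : Ideal B => P.comap φ) ⊥ ⊥ (by
      intro P hP _ _
      obtain ⟨j, hj⟩ := Set.mem_iUnion.1 hP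
      have := hprime j P hj
      exact Ideal.comap_isPrime φ P)).1 hsub
  obtain ⟨j, hj⟩ := Set.mem_iUnion.1 hP
  obtain ⟨x, hx, hPx⟩ := hann j P hj
  exact hx (h j x (fun a ha => hPx _ (hle ha)))

theorem sup_span_comm {B : Type*} [CommRing B] (N : Ideal B) (r z : B) :
    N ⊔ Ideal.span {r} ⊔ Ideal.span {z} = N ⊔ Ideal.span {z} ⊔ Ideal.span {r} :=
  sup_right_comm _ _ _

/-- If `x, z` is a regular sequence, then `x` is regular modulo `z`. -/
theorem RegOn.swap {B : Type*} [CommRing B] {N : Ideal B} {x z : B} (hx : RegOn N x)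
    (hz : RegOn (N ⊔ Ideal.span {x}) z) : RegOn (N ⊔ Ideal.span {z}) x := by
  intro m hm
  rw [mem_sup_span] at hm ⊢
  obtain ⟨m', hm'⟩ := hm
  have h1 : m' ∈ N ⊔ Ideal.span {x} := by
    apply hz
    rw [mem_sup_span]
    refine ⟨m, ?_⟩
    rw [← neg_sub]
    exact N.neg_mem hm'
  rw [mem_sup_span] at h1
  obtain ⟨m'', h1⟩ := h1
  refine ⟨m'', hx _ ?_⟩
  have : x * (m - z * m'') = (x * m - z * m') + z * (m' - x * m'') := by ring
  rw [this]
  exact N.add_mem hm' (N.mul_mem_left _ h1)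

/-- The exchange lemma: any regular element starts a regular sequence of maximal length. -/
theorem depth_exchange {B : Type*} [CommRing B] [IsNoetherianRing B] (𝔟 : Ideal B) :
    ∀ (k : ℕ) (N : Ideal B) (r : B), r ∈ 𝔟 → RegOn N r → DepthGE (𝔟 : Set B) (k + 1) N →
      DepthGE (𝔟 : Set B) k (N ⊔ Ideal.span {r}) := by
  intro k
  induction k with
  | zero => intros; trivial
  | succ k ih =>
    rintro N r hr hreg ⟨x, hx, hxreg, y, hy, hyreg, hd⟩
    -- a common regular element
    obtain ⟨z, hz, hzreg⟩ := exists_common_regular (RingHom.id B) 𝔟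
      ![N, N ⊔ Ideal.span {x}, N ⊔ Ideal.span {r}] (by
        intro j m hm
        simp only [RingHom.id_apply] at hm
        fin_cases j
        · exact hreg m (hm r hr)
        · exact hyreg m (hm y hy)
        · change ∀ a ∈ 𝔟, a * m ∈ N ⊔ Ideal.span {r} at hm
          change m ∈ N ⊔ Ideal.span {r}
          have h1 := hm x hx
          rw [mem_sup_span] at h1
          obtain ⟨m', hm'⟩ := h1
          have h2 : m' ∈ N ⊔ Ideal.span {x} := by
            apply hyreg
            rw [mem_sup_span]
            obtain ⟨u, hu⟩ := (mem_sup_span _ _ _).1 (hm y hy)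
            refine ⟨u, hreg _ ?_⟩
            have : r * (y * m' - x * u) = x * (y * m - r * u) - y * (x * m - r * m') := by ring
            rw [this]
            exact N.sub_mem (N.mul_mem_left _ hu) (N.mul_mem_left _ hm')
          obtain ⟨m'', h2⟩ := (mem_sup_span _ _ _).1 h2
          rw [mem_sup_span]
          refine ⟨m'', hxreg _ ?_⟩
          have : x * (m - r * m'') = (x * m - r * m') + r * (m' - x * m'') := by ring
          rw [this]
          exact N.add_mem hm' (N.mul_mem_left _ h2))
    have hz0 : RegOn N z := hzreg 0
    have hzx : RegOn (N ⊔ Ideal.span {x}) z := hzreg 1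
    have hzr : RegOn (N ⊔ Ideal.span {r}) z := hzreg 2
    have h1 : DepthGE (𝔟 : Set B) k (N ⊔ Ideal.span {x} ⊔ Ideal.span {z}) :=
      ih _ z hz hzx ⟨y, hy, hyreg, hd⟩
    rw [sup_span_comm] at h1
    have h2 : DepthGE (𝔟 : Set B) (k + 1) (N ⊔ Ideal.span {z}) :=
      ⟨x, hx, hxreg.swap hzx, h1⟩
    have h3 := ih (N ⊔ Ideal.span {z}) r hr (hreg.swap hzr) h2
    rw [sup_span_comm] at h3
    exact ⟨z, hz, hzr, h3⟩

/-- Depth only depends on the radical; change of rings. -/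
theorem depth_change {A B : Type*} [CommRing A] [CommRing B] [IsNoetherianRing B]
    (φ : A →+* B) (𝔞 : Ideal A) (𝔟 : Ideal B) (h1 : 𝔞.map φ ≤ 𝔟) (h2 : 𝔟 ≤ (𝔞.map φ).radical) :
    ∀ (k : ℕ) (N : Ideal B), DepthGE (𝔟 : Set B) k N → DepthGE (φ '' 𝔞) k N := by
  intro k
  induction k with
  | zero => intros; trivial
  | succ k ih =>
    intro N hN
    have hN' := hN
    obtain ⟨r, hr, hreg, -⟩ := hN
    obtain ⟨a, ha, hareg⟩ := exists_common_regular φ 𝔞 (fun _ : Unit => N) (by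
      intro _ x hx
      obtain ⟨l, hl⟩ := h2 hr
      have hle : 𝔞.map φ ≤ N.colon {x} := by
        rw [Ideal.map_le_iff_le_comap]
        intro a ha
        rw [Ideal.mem_comap, Submodule.mem_colon_singleton]
        exact hx a ha
      have h3 := hle hl
      rw [Submodule.mem_colon_singleton, smul_eq_mul] at h3
      clear hl
      induction l with
      | zero => simpa using h3
      | succ l ihl =>
        apply ihl
        apply hreg
        rwa [← mul_assoc, ← pow_succ'])
    have hab : φ a ∈ 𝔟 := h1 (Ideal.mem_map_of_mem φ ha)
    exact ⟨φ a, ⟨a, ha, rfl⟩, hareg (), ih _ (depth_exchange 𝔟 k N _ hab (hareg ()) hN')⟩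

theorem depth_sum_left {A B ι : Type*} [CommRing A] [CommRing B]
    (φ : A →+* B) (𝔞 : Ideal A) (p : ι → B → A) 
    (hsub : ∀ j b c, p j (b - c) = p j b - p j c)
    (hmul : ∀ j a b, p j (φ a * b) = a * p j b)
    (hsurj : ∀ f : ι → A, ∃ b, ∀ j, p j b = f j) :
    ∀ (k : ℕ) (N : Ideal B) (M : ι → Ideal A), (∀ b, b ∈ N ↔ ∀ j, p j b ∈ M j) →
      DepthGE (φ '' 𝔞) k N → ∀ j, DepthGE (𝔞 : Set A) k (M j) := by
  classical
  intro k
  induction k with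
  | zero => intros; trivial
  | succ k ih =>
    rintro N M hNM ⟨_, ⟨a, ha, rfl⟩, hreg, hd⟩ j
    refine ⟨a, ha, ?_, ?_⟩
    · intro m hm
      obtain ⟨b, hb⟩ := hsurj (fun i => if i = j then m else 0)
      have h1 : φ a * b ∈ N := by
        rw [hNM]
        intro i
        rw [hmul, hb]
        split_ifs with h
        · subst h; exact hm
        · simp
      have h2 := (hNM b).1 (hreg b h1) j
      rw [hb] at h2
      simpa using h2
    · refine ih _ (fun j => M j ⊔ Ideal.span {a}) ?_ hd j
      intro b
      simp only [mem_sup_span]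
      constructor
      · rintro ⟨c, hc⟩ i
        refine ⟨p i c, ?_⟩
        have := (hNM _).1 hc i
        rwa [hsub, hmul] at this
      · intro h
        choose f hf using h
        obtain ⟨c, hc⟩ := hsurj f
        refine ⟨c, (hNM _).2 fun i => ?_⟩
        rw [hsub, hmul, hc]
        exact hf i

/-- Depth of a direct sum, second direction. -/
theorem depth_sum_right {A B ι : Type*} [CommRing A] [IsNoetherianRing A] [CommRing B] [Finite ι]
    (φ : A →+* B) (𝔞 : Ideal A) (p : ι → B → A)
    (hsub : ∀ j b c, p j (b - c) = p j b - p j c)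
    (hmul : ∀ j a b, p j (φ a * b) = a * p j b)
    (hsurj : ∀ f : ι → A, ∃ b, ∀ j, p j b = f j) :
    ∀ (k : ℕ) (N : Ideal B) (M : ι → Ideal A), (∀ b, b ∈ N ↔ ∀ j, p j b ∈ M j) →
      (∀ j, DepthGE (𝔞 : Set A) k (M j)) → DepthGE (φ '' 𝔞) k N := by
  intro k
  induction k with
  | zero => intros; trivial
  | succ k ih =>
    intro N M hNM hM
    obtain ⟨a, ha, hareg⟩ := exists_common_regular (RingHom.id A) 𝔞 M (by
      intro j x hx
      obtain ⟨r, hr, hreg, -⟩ := hM j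
      exact hreg x (hx r hr))
    simp only [RingHom.id_apply] at hareg
    refine ⟨φ a, ⟨a, ha, rfl⟩, ?_, ?_⟩
    · intro m hm
      rw [hNM] at hm ⊢
      intro j
      apply hareg j
      rw [← hmul]
      exact hm j
    · refine ih _ (fun j => M j ⊔ Ideal.span {a}) ?_
        (fun j => depth_exchange 𝔞 k _ a ha (hareg j) (hM j))
      intro b
      simp only [mem_sup_span]
      constructor
      · rintro ⟨c, hc⟩ i
        refine ⟨p i c, ?_⟩
        have := (hNM _).1 hc i
        rwa [hsub, hmul] at this
      · intro h
        choose f hf using h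
        obtain ⟨c, hc⟩ := hsurj f
        refine ⟨c, (hNM _).2 fun i => ?_⟩
        rw [hsub, hmul, hc]
        exact hf i

/-- The lengths of regular sequences are bounded. -/
theorem depth_bounded {B : Type*} [CommRing B] [IsNoetherianRing B] (𝔟 : Ideal B) (h𝔟 : 𝔟 ≠ ⊤)
    (N : Ideal B) : N ≤ 𝔟 → ∃ k, ¬ DepthGE (𝔟 : Set B) k N := by
  induction N using WellFoundedGT.induction with
  | ind N ih =>
    intro hN
    by_contra hcon
    push Not at hcon
    obtain ⟨r, hr, hreg, -⟩ := hcon 1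
    have hlt : N < N ⊔ Ideal.span {r} := by
      refine lt_of_le_of_ne le_sup_left fun heq => ?_
      have h1 : r ∈ N := by
        rw [heq]; exact Ideal.mem_sup_right (Ideal.mem_span_singleton_self r)
      have h2 : (1 : B) ∈ N := hreg 1 (by rwa [mul_one])
      exact h𝔟 ((Ideal.eq_top_iff_one _).2 (hN h2))
    obtain ⟨k, hk⟩ := ih _ hlt (sup_le hN ((Ideal.span_singleton_le_iff_mem _).2 hr))
    exact hk (depth_exchange 𝔟 k N r hr hreg (hcon (k + 1)))

open scoped Pointwise in
open RingTheory.Sequence in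
theorem weaklyRegular_iff {B : Type*} [CommRing B] (r : B) (rs : List B) (N : Ideal B) :
    IsWeaklyRegular (B ⧸ N) (r :: rs) ↔
      RegOn N r ∧ IsWeaklyRegular (B ⧸ (N ⊔ Ideal.span {r})) rs := by
  rw [isWeaklyRegular_cons_iff]
  have hsmul : ∀ m, r • (Ideal.Quotient.mk N m) = Ideal.Quotient.mk N (r * m) := fun _ => rfl
  apply and_congr
  · rw [isSMulRegular_iff_right_eq_zero_of_smul]
    constructor
    · intro h m hm
      rw [← Ideal.Quotient.eq_zero_iff_mem] at hm ⊢
      exact h _ (by rw [hsmul, hm])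
    · intro h x hx
      obtain ⟨m, rfl⟩ := Ideal.Quotient.mk_surjective x
      rw [hsmul, Ideal.Quotient.eq_zero_iff_mem] at hx
      exact Ideal.Quotient.eq_zero_iff_mem.2 (h m hx)
  · have e : QuotSMulTop r (B ⧸ N) ≃ₗ[B] (B ⧸ (N ⊔ Ideal.span {r})) := by
      let S : Submodule B (B ⧸ N) := Submodule.map (Submodule.mkQ N) (N ⊔ Ideal.span {r})
      have hS : (r • ⊤ : Submodule B (B ⧸ N)) = S := by
        simp only [S, Submodule.map_sup, Submodule.mkQ_map_self, bot_sup_eq]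
        ext x
        rw [Submodule.mem_smul_pointwise_iff_exists, Submodule.mem_map]
        constructor
        · rintro ⟨y, -, rfl⟩
          obtain ⟨m, rfl⟩ := Ideal.Quotient.mk_surjective y
          exact ⟨r * m, Ideal.mul_mem_right _ _ (Ideal.mem_span_singleton_self r), rfl⟩
        · rintro ⟨y, hy, rfl⟩
          obtain ⟨m, rfl⟩ := Ideal.mem_span_singleton'.1 hy
          exact ⟨Ideal.Quotient.mk N m, trivial, by rw [mul_comm]; rfl⟩
      exact (Submodule.quotEquivOfEq _ _ hS).trans
        (Submodule.quotientQuotientEquivQuotient N (N ⊔ Ideal.span {r}) le_sup_left)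
    exact e.isWeaklyRegular_congr rs

open RingTheory.Sequence in
theorem depthGE_iff {B : Type*} [CommRing B] (T : Set B) :
    ∀ (k : ℕ) (N : Ideal B), DepthGE T k N ↔
      ∃ rs : List B, rs.length = k ∧ (∀ r ∈ rs, r ∈ T) ∧ IsWeaklyRegular (B ⧸ N) rs := by
  intro k
  induction k with
  | zero =>
    intro N
    exact ⟨fun _ => ⟨[], rfl, by simp, IsWeaklyRegular.nil _ _⟩, fun _ => trivial⟩
  | succ k ih =>
    intro N
    constructor
    · rintro ⟨r, hr, hreg, hd⟩
      obtain ⟨rs, hlen, hT, hw⟩ := (ih _).1 hd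
      exact ⟨r :: rs, by simp [hlen], by simpa using ⟨hr, hT⟩,
        (weaklyRegular_iff r rs N).2 ⟨hreg, hw⟩⟩
    · rintro ⟨rs, hlen, hT, hw⟩
      cases rs with
      | nil => simp at hlen
      | cons r rs =>
        obtain ⟨h1, h2⟩ := (weaklyRegular_iff r rs N).1 hw
        exact ⟨r, hT r (by simp), h1, (ih _).2 ⟨rs, by simpa using hlen,
          fun s hs => hT s (by simp [hs]), h2⟩⟩

open RingTheory.Sequence in
theorem isRegular_iff_weakly {B : Type*} [CommRing B] (𝔟 : Ideal B) (h𝔟 : 𝔟 ≠ ⊤) (N : Ideal B)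
    (hN : N ≤ 𝔟) (rs : List B) (hrs : ∀ r ∈ rs, r ∈ 𝔟) :
    IsRegular (B ⧸ N) rs ↔ IsWeaklyRegular (B ⧸ N) rs := by
  refine ⟨fun h => h.toIsWeaklyRegular, fun h => ⟨h, fun htop => ?_⟩⟩
  have h1 : (Ideal.ofList rs • ⊤ : Submodule B (B ⧸ N)) ≤ Submodule.map (Submodule.mkQ N) 𝔟 := by
    rw [Submodule.smul_le]
    intro r hr x _
    obtain ⟨m, rfl⟩ := Ideal.Quotient.mk_surjective x
    have hr' : r ∈ 𝔟 := by
      have : Ideal.ofList rs ≤ 𝔟 := Ideal.span_le.2 hrs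
      exact this hr
    exact ⟨r * m, 𝔟.mul_mem_right m hr', rfl⟩
  have h2 : Ideal.Quotient.mk N 1 ∈ Submodule.map (Submodule.mkQ N) 𝔟 := by
    apply h1
    rw [← htop]
    trivial
  obtain ⟨b, hb, hb1⟩ := h2
  have := Ideal.Quotient.eq.1 hb1
  apply h𝔟
  rw [Ideal.eq_top_iff_one]
  have h3 := 𝔟.sub_mem hb (hN this)
  simpa using h3

/-! ### Part 3: powers of cover ideals -/

theorem mem_coverIdeal_iff {n : ℕ} {K : Type*} [Field K] (E : Finset (Finset (Fin n)))
    (f : MvPolynomial (Fin n) K) :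
    f ∈ coverIdeal K E ↔ ∀ β ∈ f.support, ∀ e ∈ E, ∃ i ∈ e, β i ≠ 0 := by
  have h : ∀ e : Finset (Fin n), {p : MvPolynomial (Fin n) K | ∃ i ∈ e, p = X i} =
      X '' (e : Set (Fin n)) := by
    intro e
    ext p
    simp [eq_comm]
  simp only [coverIdeal, Submodule.mem_iInf, h, mem_ideal_span_X_image]
  constructor
  · intro h β hβ e he
    exact h e he β hβ
  · intro h e he β hβ
    exact h β hβ e he

/-- Polynomials all of whose monomials have `e`-weight at least `t`. -/
def weightIdeal {n : ℕ} (K : Type*) [Field K] (e : Finset (Fin n)) (t : ℕ) :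
    Ideal (MvPolynomial (Fin n) K) where
  carrier := {f | ∀ β ∈ f.support, t ≤ ∑ i ∈ e, β i}
  zero_mem' := by simp
  add_mem' := by
    classical
    intro f g hf hg β hβ
    rcases Finset.mem_union.1 (support_add hβ) with h | h
    · exact hf β h
    · exact hg β h
  smul_mem' := by
    classical
    intro f g hg β hβ
    obtain ⟨a, -, b, hb, rfl⟩ := Finset.mem_add.1 (support_mul f g hβ)
    have := hg b hb
    simp only [Finsupp.add_apply, Finset.sum_add_distrib]
    omega

theorem mem_weightIdeal {n : ℕ} {K : Type*} [Field K] (e : Finset (Fin n)) (t : ℕ)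
    (f : MvPolynomial (Fin n) K) :
    f ∈ weightIdeal K e t ↔ ∀ β ∈ f.support, t ≤ ∑ i ∈ e, β i := Iff.rfl

theorem coverIdeal_pow_le {n : ℕ} (K : Type*) [Field K] (E : Finset (Finset (Fin n)))
    (e : Finset (Fin n)) (he : e ∈ E) (t : ℕ) : coverIdeal K E ^ t ≤ weightIdeal K e t := by
  classical
  induction t with
  | zero =>
    intro f _
    rw [mem_weightIdeal]
    simp
  | succ t ih =>
    rw [pow_succ, Ideal.mul_le]
    intro f hf g hg
    rw [mem_weightIdeal]
    intro β hβ
    obtain ⟨a, ha, b, hb, rfl⟩ := Finset.mem_add.1 (support_mul f g hβ)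
    have h1 := ih hf a ha
    obtain ⟨i, hi, hbi⟩ := (mem_coverIdeal_iff E g).1 hg b hb e he
    have h2 : b i ≤ ∑ i ∈ e, b i := Finset.single_le_sum (fun _ _ => Nat.zero_le _) hi
    simp only [Finsupp.add_apply, Finset.sum_add_distrib]
    omega

theorem mem_coverIdeal_pow_iff {n : ℕ} {K : Type*} [Field K] (E : Finset (Finset (Fin n)))
    (hbal : IsBalanced E) (t : ℕ) (ht : 1 ≤ t) (f : MvPolynomial (Fin n) K) :
    f ∈ coverIdeal K E ^ t ↔ ∀ β ∈ f.support, ∀ e ∈ E, t ≤ ∑ i ∈ e, β i := by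
  constructor
  · intro hf β hβ e he
    exact coverIdeal_pow_le K E e he t hf β hβ
  · intro h
    rw [f.as_sum]
    refine Ideal.sum_mem _ fun β hβ => ?_
    obtain ⟨D, hD, hDe⟩ := weight_decomposition E hbal t ht (fun i => β i)
    have h1 : monomial β (coeff β f) = C (coeff β f) *
        ∏ j : Fin t, monomial (Finsupp.equivFunOnFinite.symm (D j)) (1 : K) := by
      rw [← monomial_sum_one, C_mul_monomial, mul_one]
      have h0 : β = ∑ j : Fin t, Finsupp.equivFunOnFinite.symm (D j) := by
        ext i
        rw [Finsupp.finsetSum_apply]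
        exact (hD i).symm
      rw [← h0]
    rw [h1]
    apply Ideal.mul_mem_left
    have h2 := Ideal.prod_mem_prod (s := (Finset.univ : Finset (Fin t)))
      (I := fun _ => coverIdeal K E)
      (x := fun j => monomial (Finsupp.equivFunOnFinite.symm (D j)) (1 : K)) (by
        intro j _
        rw [mem_coverIdeal_iff]
        intro γ hγ e he
        have hγ' := Finset.mem_singleton.1 (support_monomial_subset hγ)
        subst hγ'
        by_contra hcon
        push Not at hcon
        have h3 := (hDe e he j).1 (h β hβ e he)
        rw [Finset.sum_eq_zero (fun i hi => by simpa using hcon i hi)] at h3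
        omega)
    simpa using h2

/-- The exponent `a + N γ`. -/
noncomputable def shift {n N : ℕ} (a : Fin n → Fin N) (γ : Fin n →₀ ℕ) : Fin n →₀ ℕ :=
  Finsupp.equivFunOnFinite.symm (fun i => (a i : ℕ) + N * γ i)

theorem shift_apply {n N : ℕ} (a : Fin n → Fin N) (γ : Fin n →₀ ℕ) (i : Fin n) :
    shift a γ i = a i + N * γ i := rfl

theorem divmod_unique {N a b c d : ℕ} (ha : a < N) (hb : b < N) (h : a + N * c = b + N * d) :
    a = b ∧ c = d := by
  have h1 : (a + N * c) % N = a := by rw [Nat.add_mul_mod_self_left, Nat.mod_eq_of_lt ha]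
  have h2 : (b + N * d) % N = b := by rw [Nat.add_mul_mod_self_left, Nat.mod_eq_of_lt hb]
  have h3 : a = b := by rw [← h1, ← h2, h]
  subst h3
  refine ⟨rfl, ?_⟩
  have h4 : N * c = N * d := by omega
  exact Nat.eq_of_mul_eq_mul_left (by omega) h4

theorem shift_inj {n N : ℕ} {a b : Fin n → Fin N} {γ δ : Fin n →₀ ℕ}
    (h : shift a γ = shift b δ) : a = b ∧ γ = δ := by
  have h1 : ∀ i, a i = b i ∧ γ i = δ i := by
    intro i
    have h2 := DFunLike.congr_fun h i
    rw [shift_apply, shift_apply] at h2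
    have h3 := divmod_unique (a i).2 (b i).2 h2
    exact ⟨Fin.ext h3.1, h3.2⟩
  exact ⟨funext fun i => (h1 i).1, Finsupp.ext fun i => (h1 i).2⟩

theorem exists_shift {n N : ℕ} (hN : 0 < N) (β : Fin n →₀ ℕ) :
    ∃ (a : Fin n → Fin N) (γ : Fin n →₀ ℕ), shift a γ = β := by
  refine ⟨fun i => ⟨β i % N, Nat.mod_lt _ hN⟩,
    Finsupp.equivFunOnFinite.symm (fun i => β i / N), ?_⟩
  ext i
  rw [shift_apply]
  exact Nat.mod_add_div _ _

theorem exists_proj {n N : ℕ} {K : Type*} [Field K] (a : Fin n → Fin N)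
    (f : MvPolynomial (Fin n) K) :
    ∃ g : MvPolynomial (Fin n) K, ∀ γ, coeff γ g = coeff (shift a γ) f := by
  classical
  induction f using MvPolynomial.induction_on' with
  | monomial β c =>
    by_cases h : ∃ γ, shift a γ = β
    · obtain ⟨γ, hγ⟩ := h
      refine ⟨monomial γ c, fun δ => ?_⟩
      rw [coeff_monomial, coeff_monomial]
      congr 1
      rw [← hγ]
      exact propext ⟨fun h => by rw [h], fun h => (shift_inj h).2⟩
    · push Not at h
      exact ⟨0, fun δ => by rw [coeff_zero, coeff_monomial, if_neg (fun h' => h δ h'.symm)]⟩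
  | add f g ihf ihg =>
    obtain ⟨g1, h1⟩ := ihf
    obtain ⟨g2, h2⟩ := ihg
    exact ⟨g1 + g2, fun γ => by rw [coeff_add, coeff_add, h1, h2]⟩

/-- The component of `f` of exponents congruent to `a` modulo `N`. -/
noncomputable def proj {n N : ℕ} {K : Type*} [Field K] (a : Fin n → Fin N)
    (f : MvPolynomial (Fin n) K) : MvPolynomial (Fin n) K :=
  (exists_proj a f).choose

theorem coeff_proj {n N : ℕ} {K : Type*} [Field K] (a : Fin n → Fin N)
    (f : MvPolynomial (Fin n) K) (γ : Fin n →₀ ℕ) :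
    coeff γ (proj a f) = coeff (shift a γ) f :=
  (exists_proj a f).choose_spec γ

theorem proj_sub {n N : ℕ} {K : Type*} [Field K] (a : Fin n → Fin N)
    (f g : MvPolynomial (Fin n) K) : proj a (f - g) = proj a f - proj a g := by
  ext γ
  simp only [coeff_proj, coeff_sub]

theorem proj_add {n N : ℕ} {K : Type*} [Field K] (a : Fin n → Fin N)
    (f g : MvPolynomial (Fin n) K) : proj a (f + g) = proj a f + proj a g := by
  ext γ
  simp only [coeff_proj, coeff_add]

theorem proj_sum {n N : ℕ} {K ι : Type*} [Field K] (a : Fin n → Fin N) (s : Finset ι)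
    (f : ι → MvPolynomial (Fin n) K) : proj a (∑ i ∈ s, f i) = ∑ i ∈ s, proj a (f i) := by
  ext γ
  simp only [coeff_proj, coeff_sum]

theorem proj_expand_mul {n N : ℕ} {K : Type*} [Field K] (a : Fin n → Fin N)
    (s f : MvPolynomial (Fin n) K) : proj a (expand N s * f) = s * proj a f := by
  classical
  induction s using MvPolynomial.induction_on' with
  | monomial δ c =>
    ext γ
    rw [coeff_proj, expand_monomial, coeff_monomial_mul', coeff_monomial_mul', coeff_proj]
    have hle : N • δ ≤ shift a γ ↔ δ ≤ γ := by
      rw [Finsupp.le_def, Finsupp.le_def]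
      refine forall_congr' fun i => ?_
      rw [shift_apply, Finsupp.smul_apply, smul_eq_mul]
      have := (a i).2
      constructor
      · intro h
        by_contra hlt
        have h2 : N * (γ i + 1) ≤ N * δ i := Nat.mul_le_mul_left N (by omega)
        rw [mul_add] at h2
        omega
      · intro h
        have h2 : N * δ i ≤ N * γ i := Nat.mul_le_mul_left N h
        omega
    by_cases h : δ ≤ γ
    · rw [if_pos (hle.2 h), if_pos h]
      have : shift a γ - N • δ = shift a (γ - δ) := by
        ext i
        rw [Finsupp.tsub_apply, shift_apply, shift_apply, Finsupp.smul_apply, Finsupp.tsub_apply,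
          smul_eq_mul, Nat.mul_sub]
        have h2 : N * δ i ≤ N * γ i := Nat.mul_le_mul_left N (h i)
        omega
      rw [this]
    · rw [if_neg (fun h' => h (hle.1 h')), if_neg h]
  | add p q hp hq =>
    rw [map_add, add_mul, add_mul, proj_add, hp, hq]

theorem proj_surj {n N : ℕ} {K : Type*} [Field K]
    (f : (Fin n → Fin N) → MvPolynomial (Fin n) K) :
    ∃ b : MvPolynomial (Fin n) K, ∀ a, proj a b = f a := by
  classical
  refine ⟨∑ a : Fin n → Fin N, expand N (f a) * monomial (shift a 0) 1, fun a => ?_⟩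
  rw [proj_sum, Finset.sum_eq_single a]
  · rw [proj_expand_mul]
    have : proj a (monomial (shift a 0) (1 : K)) = 1 := by
      ext γ
      rw [coeff_proj, coeff_monomial, coeff_one]
      congr 1
      exact propext ⟨fun h => (shift_inj h).2, fun h => by rw [← h]⟩
    rw [this, mul_one]
  · intro b _ hb
    rw [proj_expand_mul]
    have : proj a (monomial (shift b 0) (1 : K)) = 0 := by
      ext γ
      rw [coeff_proj, coeff_monomial, coeff_zero, if_neg]
      exact fun h => hb (shift_inj h).1
    rw [this, mul_zero]
  · intro h
    exact absurd (Finset.mem_univ _) h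

theorem mem_pow_iff_proj {n : ℕ} {K : Type*} [Field K] (E : Finset (Finset (Fin n)))
    (hbal : IsBalanced E) (t : ℕ) (ht : 1 ≤ t) (f : MvPolynomial (Fin n) K) :
    f ∈ coverIdeal K E ^ t ↔ ∀ a : Fin n → Fin (t + 1),
      proj a f ∈ coverIdeal K (E.filter (fun e => ∑ i ∈ e, (a i : ℕ) < t)) := by
  rw [mem_coverIdeal_pow_iff E hbal t ht]
  simp only [mem_coverIdeal_iff, mem_support_iff, Finset.mem_filter, coeff_proj]
  have hsum : ∀ (a : Fin n → Fin (t + 1)) (γ : Fin n →₀ ℕ) (e : Finset (Fin n)),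
      ∑ i ∈ e, shift a γ i = ∑ i ∈ e, (a i : ℕ) + (t + 1) * ∑ i ∈ e, γ i := by
    intro a γ e
    rw [Finset.mul_sum, ← Finset.sum_add_distrib]
    rfl
  constructor
  · intro h a γ hγ e he
    by_contra hcon
    push Not at hcon
    have h1 := h _ hγ e he.1
    rw [hsum, Finset.sum_eq_zero hcon] at h1
    omega
  · intro h β hβ e he
    obtain ⟨a, γ, rfl⟩ := exists_shift (Nat.succ_pos t) β
    rw [hsum]
    by_contra hlt
    obtain ⟨i, hi, hγi⟩ := h a γ hβ e ⟨he, by omega⟩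
    have h2 : γ i ≤ ∑ i ∈ e, γ i := Finset.single_le_sum (fun _ _ => Nat.zero_le _) hi
    have h3 : (t + 1) * 1 ≤ (t + 1) * ∑ i ∈ e, γ i := Nat.mul_le_mul_left _ (by omega)
    omega

/-- The homogeneous maximal ideal. -/
noncomputable def maxIdl (n : ℕ) (K : Type*) [Field K] : Ideal (MvPolynomial (Fin n) K) :=
  Ideal.span (Set.range (X : Fin n → MvPolynomial (Fin n) K))

theorem mem_maxIdl {n : ℕ} {K : Type*} [Field K] (f : MvPolynomial (Fin n) K) :
    f ∈ maxIdl n K ↔ ∀ β ∈ f.support, ∃ i, β i ≠ 0 := by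
  rw [maxIdl, ← Set.image_univ, mem_ideal_span_X_image]
  simp

theorem maxIdl_ne_top (n : ℕ) (K : Type*) [Field K] : maxIdl n K ≠ ⊤ := by
  rw [Ne, Ideal.eq_top_iff_one, mem_maxIdl]
  intro h
  obtain ⟨i, hi⟩ := h 0 (by simp)
  simp at hi

theorem depth_pow_iff {n : ℕ} {K : Type*} [Field K] (E : Finset (Finset (Fin n)))
    (hbal : IsBalanced E) (t : ℕ) (ht : 1 ≤ t) (k : ℕ) :
    DepthGE (maxIdl n K : Set (MvPolynomial (Fin n) K)) k (coverIdeal K E ^ t) ↔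
      ∀ a : Fin n → Fin (t + 1), DepthGE (maxIdl n K : Set (MvPolynomial (Fin n) K)) k
        (coverIdeal K (E.filter (fun e => ∑ i ∈ e, (a i : ℕ) < t))) := by
  let φ : MvPolynomial (Fin n) K →+* MvPolynomial (Fin n) K :=
    (expand (t + 1) : MvPolynomial (Fin n) K →ₐ[K] MvPolynomial (Fin n) K).toRingHom
  have hφX : ∀ i, φ (X i) = X i ^ (t + 1) := fun i => expand_X _ i
  have hX : ∀ i, (X i : MvPolynomial (Fin n) K) ∈ maxIdl n K :=
    fun i => Ideal.subset_span ⟨i, rfl⟩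
  have h1 : (maxIdl n K).map φ ≤ maxIdl n K := by
    rw [Ideal.map_le_iff_le_comap]
    refine Ideal.span_le.2 ?_
    rintro _ ⟨i, rfl⟩
    rw [SetLike.mem_coe, Ideal.mem_comap, hφX]
    exact Ideal.pow_mem_of_mem _ (hX i) _ (Nat.succ_pos t)
  have h2 : maxIdl n K ≤ ((maxIdl n K).map φ).radical := by
    refine Ideal.span_le.2 ?_
    rintro _ ⟨i, rfl⟩
    refine ⟨t + 1, ?_⟩
    rw [← hφX]
    exact Ideal.mem_map_of_mem φ (hX i)
  have hmul : ∀ (j : Fin n → Fin (t + 1)) (a b : MvPolynomial (Fin n) K),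
      proj j (φ a * b) = a * proj j b := fun j a b => proj_expand_mul j a b
  constructor
  · intro h
    exact depth_sum_left φ (maxIdl n K) proj proj_sub hmul proj_surj k _ _
      (mem_pow_iff_proj E hbal t ht) (depth_change φ _ _ h1 h2 k _ h)
  · intro h
    refine DepthGE.mono ?_ k _ (depth_sum_right φ (maxIdl n K) proj proj_sub hmul proj_surj k
      (coverIdeal K E ^ t) _ (mem_pow_iff_proj E hbal t ht) h)
    rintro _ ⟨a, ha, rfl⟩
    exact h1 (Ideal.mem_map_of_mem φ ha)

theorem depth_pow_succ {n : ℕ} {K : Type*} [Field K] (E : Finset (Finset (Fin n)))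
    (hbal : IsBalanced E) (t : ℕ) (ht : 1 ≤ t) (k : ℕ)
    (h : DepthGE (maxIdl n K : Set (MvPolynomial (Fin n) K)) k (coverIdeal K E ^ (t + 1))) :
    DepthGE (maxIdl n K : Set (MvPolynomial (Fin n) K)) k (coverIdeal K E ^ t) := by
  rw [depth_pow_iff E hbal t ht]
  rw [depth_pow_iff E hbal (t + 1) (by omega)] at h
  intro a
  obtain ⟨D, hD, hDe⟩ := weight_decomposition E hbal t ht (fun i => (a i : ℕ))
  let j : Fin t := ⟨0, ht⟩
  have h1 := h (fun i => ⟨(a i : ℕ) + min (D j i) 1, by have := (a i).2; omega⟩)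
  have h2 : E.filter (fun e => ∑ i ∈ e, ((a i : ℕ) + min (D j i) 1) < t + 1) =
      E.filter (fun e => ∑ i ∈ e, (a i : ℕ) < t) := by
    apply Finset.filter_congr
    intro e he
    rw [Finset.sum_add_distrib]
    have hle : ∑ i ∈ e, min (D j i) 1 ≤ ∑ i ∈ e, D j i :=
      Finset.sum_le_sum fun i _ => min_le_left _ _
    obtain ⟨h3, h4⟩ := hDe e he j
    constructor
    · intro h5
      by_contra h6
      have h7 := h3 (by omega)
      have h8 : 1 ≤ ∑ i ∈ e, min (D j i) 1 := by
        obtain ⟨i, hi, hne⟩ := Finset.exists_ne_zero_of_sum_ne_zero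
          (s := e) (f := fun i => D j i) (by omega)
        have h9 : min (D j i) 1 ≤ ∑ i ∈ e, min (D j i) 1 :=
          Finset.single_le_sum (f := fun i => min (D j i) 1) (fun _ _ => Nat.zero_le _) hi
        have h10 : min (D j i) 1 = 1 := min_eq_right (Nat.one_le_iff_ne_zero.2 hne)
        omega
      omega
    · intro h5
      have h7 := h4 (by omega)
      omega
  simp only at h1
  rw [h2] at h1
  exact h1

theorem coverIdeal_pow_le_maxIdl {n : ℕ} {K : Type*} [Field K] (E : Finset (Finset (Fin n)))
    (hE : E.Nonempty) (t : ℕ) (ht : 1 ≤ t) : coverIdeal K E ^ t ≤ maxIdl n K := by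
  refine (Ideal.pow_le_self (by omega)).trans ?_
  obtain ⟨e, he⟩ := hE
  intro f hf
  rw [mem_maxIdl]
  intro β hβ
  obtain ⟨i, -, hi⟩ := (mem_coverIdeal_iff E f).1 hf β hβ e he
  exact ⟨i, hi⟩

theorem quotDepth_eq {n : ℕ} {K : Type*} [Field K] (I : Ideal (MvPolynomial (Fin n) K))
    (hI : I ≤ maxIdl n K) :
    quotDepth K I = sSup {k : ℕ | DepthGE (maxIdl n K : Set (MvPolynomial (Fin n) K)) k I} := by
  rw [quotDepth]
  congr 1
  ext k
  rw [Set.mem_ofPred_eq, Set.mem_ofPred_eq, depthGE_iff]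
  refine exists_congr fun rs => and_congr_right fun _ => and_congr_right fun hrs => ?_
  exact isRegular_iff_weakly (maxIdl n K) (maxIdl_ne_top n K) I hI rs hrs

theorem DepthGE.anti {B : Type*} [CommRing B] {T : Set B} {k l : ℕ} (hkl : k ≤ l) (N : Ideal B)
    (h : DepthGE T l N) : DepthGE T k N := by
  induction l, hkl using Nat.le_induction with
  | base => exact h
  | succ l _ ih => exact ih (DepthGE.pred l N h)

/-- For a balanced hypergraph `H`, the depth function `t ↦ depth R/J(H)^t` is
non-increasing. -/
theorem depth_coverIdeal_pow_antitone {n : ℕ} (K : Type*) [Field K]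
    (E : Finset (Finset (Fin n))) (hbal : IsBalanced E) :
    ∀ t : ℕ, 1 ≤ t →
      quotDepth K ((coverIdeal K E) ^ (t + 1)) ≤ quotDepth K ((coverIdeal K E) ^ t) := by
  intro t ht
  rcases E.eq_empty_or_nonempty with rfl | hE
  · have h : coverIdeal K (∅ : Finset (Finset (Fin n))) = ⊤ := by simp [coverIdeal]
    rw [h, ← Ideal.one_eq_top, one_pow, one_pow]
  · rw [quotDepth_eq _ (coverIdeal_pow_le_maxIdl E hE (t + 1) (by omega)),
      quotDepth_eq _ (coverIdeal_pow_le_maxIdl E hE t ht)]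
    obtain ⟨k, hk⟩ := depth_bounded (maxIdl n K) (maxIdl_ne_top n K) _
      (coverIdeal_pow_le_maxIdl E hE t ht)
    apply csSup_le_csSup
    · refine ⟨k, fun l hl => ?_⟩
      by_contra hlt
      exact hk (DepthGE.anti (by omega) _ hl)
    · exact ⟨0, trivial⟩
    · intro l hl
      exact depth_pow_succ E hbal t ht l hl
end
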